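/- Let R be a commutative ring, x = (x_1,…,x_n) variables, f = (f_1,…,f_n) polynomials in R[x] each of total degree at least 1, and δ_f = Σ_{i=1}^n (deg f_i − 1). Suppose the quotient R[x]/(f)_x is finitely generated as an R-module. Then for all δ ≥ 0 and ε ≥ 0 the following equality of R-submodules of R[x] holds: (f)_x ∩ R[x^{≤δ_f+δ+ε+1}] = ((f)_x ∩ R[x^{≤δ_f+ε+1}])·R[x^{≤δ}]. -/

import Mathlib

namespace BezAux

open MvPolynomial

theorem pairing {T σ : Type*} [CommRing T] [DecidableEq σ] (v : σ → T)
    (hv : ∀ (s : Finset σ) (k : σ), k ∉ s → ∀ e : T,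
      e * v k ∈ Ideal.span (v '' s) → e ∈ Ideal.span (v '' s))
    (I : Ideal T) (c : σ → T) (hc : ∀ k l, v k * c l - v l * c k ∈ I) (s : Finset σ) :
    ∀ e : σ → T, ∑ i ∈ s, e i * v i = 0 → ∑ i ∈ s, e i * c i ∈ I := by
  induction s using Finset.induction_on with
  | empty => intro e _; simp
  | insert k s hk ih =>
    intro e he
    rw [Finset.sum_insert hk] at he ⊢
    have h1 : e k ∈ Ideal.span (v '' s) := by
      apply hv s k hk
      rw [eq_neg_of_add_eq_zero_left he]
      refine neg_mem (Ideal.sum_mem _ fun i hi => Ideal.mul_mem_left _ _ (Ideal.subset_span ⟨i, hi, rfl⟩))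
    obtain ⟨b, hb⟩ : ∃ b : σ → T, ∑ i ∈ s, b i * v i = e k := by
      obtain ⟨c, hc⟩ := (Submodule.mem_span_image_finset_iff_exists_fun T).1 h1
      refine ⟨fun i => if h : i ∈ s then c ⟨i, h⟩ else 0, ?_⟩
      rw [← hc, ← Finset.sum_attach s]
      simp
    have h2 := ih (fun i => e i + b i * v k) (by
      rw [← he, ← hb, Finset.sum_mul, ← Finset.sum_add_distrib]
      exact Finset.sum_congr rfl fun i _ => by ring)
    have h3 : ∑ i ∈ s, b i * (v i * c k - v k * c i) ∈ I :=
      Ideal.sum_mem _ fun i _ => Ideal.mul_mem_left _ _ (hc i k)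
    convert add_mem h2 h3 using 1
    rw [← hb, Finset.sum_mul, ← Finset.sum_add_distrib, ← Finset.sum_add_distrib]
    exact Finset.sum_congr rfl fun i _ => by ring

theorem det_sub_row {T σ : Type*} [CommRing T] [DecidableEq σ] [Fintype σ] (v : σ → T)
    (hv : ∀ (s : Finset σ) (k : σ), k ∉ s → ∀ e : T,
      e * v k ∈ Ideal.span (v '' s) → e ∈ Ideal.span (v '' s))
    (w : σ → T) (C : Matrix σ σ T) (hC : ∀ i, ∑ j, C i j * v j = w i) (i : σ) (b : σ → T)
    (hb : ∑ j, b j * v j = w i) :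
    C.det - (C.updateRow i b).det ∈ Ideal.span (Set.range w) := by
  have key : ∀ e : σ → T, (C.updateRow i e).det = ∑ k, e k * C.adjugate k i := by
    intro e
    have := Matrix.det_eq_sum_mul_adjugate_row (C.updateRow i e) i
    rw [this]
    refine Finset.sum_congr rfl fun k _ => ?_
    simp [Matrix.adjugate_apply]
  have h0 : C.det = ∑ k, C i k * C.adjugate k i := Matrix.det_eq_sum_mul_adjugate_row C i
  rw [h0, key, ← Finset.sum_sub_distrib]
  simp_rw [← sub_mul]
  apply pairing v hv (Ideal.span (Set.range w)) (fun k => C.adjugate k i) _ Finset.univ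
  · simp_rw [sub_mul]
    rw [Finset.sum_sub_distrib, hC, hb, sub_self]
  · intro k l
    set Cl := C.updateRow i (Pi.single l 1) with hCl
    have e1 : C.adjugate l i = Cl.det := by rw [Matrix.adjugate_apply]
    have e2 : C.adjugate k i = Cl.adjugate k i := by
      rw [Matrix.adjugate_apply, Matrix.adjugate_apply, hCl, Matrix.updateRow_idem]
    have e3 : v k * Cl.det = ∑ j, Cl.adjugate k j * (Cl.mulVec v) j := by
      have : Cl.adjugate.mulVec (Cl.mulVec v) = Cl.det • v := by
        rw [Matrix.mulVec_mulVec, Matrix.adjugate_mul, Matrix.smul_mulVec, Matrix.one_mulVec]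
      have := congrFun this k
      simp only [Matrix.mulVec, dotProduct, Pi.smul_apply, smul_eq_mul] at this ⊢
      rw [mul_comm, ← this]
    have e4 : (Cl.mulVec v) i = v l := by
      simp [hCl, Matrix.mulVec, Matrix.updateRow_self]
    change v k * C.adjugate l i - v l * C.adjugate k i ∈ _
    rw [e1, e3, e2, ← Finset.add_sum_erase _ _ (Finset.mem_univ i), e4]
    rw [mul_comm (v l), add_sub_cancel_left]
    refine Ideal.sum_mem _ fun j hj => Ideal.mul_mem_left _ _ ?_
    have hji := Finset.ne_of_mem_erase hj
    have : (Cl.mulVec v) j = w j := by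
      rw [← hC j, hCl]
      simp [Matrix.mulVec, dotProduct, Matrix.updateRow_ne hji]
    rw [this]
    exact Ideal.subset_span ⟨j, rfl⟩

theorem det_sub {T σ : Type*} [CommRing T] [DecidableEq σ] [Fintype σ] (v : σ → T)
    (hv : ∀ (s : Finset σ) (k : σ), k ∉ s → ∀ e : T,
      e * v k ∈ Ideal.span (v '' s) → e ∈ Ideal.span (v '' s))
    (w : σ → T) (A B : Matrix σ σ T) (hA : ∀ i, ∑ j, A i j * v j = w i)
    (hB : ∀ i, ∑ j, B i j * v j = w i) :
    A.det - B.det ∈ Ideal.span (Set.range w) := by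
  have key : ∀ s : Finset σ,
      A.det - (Matrix.of fun i => if i ∈ s then B i else A i).det ∈ Ideal.span (Set.range w) := by
    intro s
    induction s using Finset.induction_on with
    | empty => 
      have : (Matrix.of fun i => if i ∈ (∅ : Finset σ) then B i else A i) = A := by ext; simp
      rw [this, sub_self]; exact zero_mem _
    | insert k s hk ih =>
      have h := det_sub_row v hv w (Matrix.of fun i => if i ∈ s then B i else A i)
        (by intro i; by_cases h : i ∈ s <;> simp [h, hA, hB]) k (B k) (hB k)
      have e : (Matrix.of fun i => if i ∈ s then B i else A i).updateRow k (B k) =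
          Matrix.of fun i => if i ∈ insert k s then B i else A i := by
        ext i j
        by_cases hik : i = k
        · subst hik; simp
        · simp [hik]
      rw [e] at h
      convert add_mem ih h using 1
      ring
  have := key Finset.univ
  have e : (Matrix.of fun i => if i ∈ (Finset.univ : Finset σ) then B i else A i) = B := by
    ext; simp
  rwa [e] at this

theorem var_reg {S σ : Type*} [CommRing S] [DecidableEq σ] (y : σ → S)
    (s : Finset σ) (k : σ) (hk : k ∉ s) (e : MvPolynomial σ S)
    (h : e * (X k - C (y k)) ∈ Ideal.span ((fun i => (X i - C (y i) : MvPolynomial σ S)) '' s)) :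
    e ∈ Ideal.span ((fun i => (X i - C (y i) : MvPolynomial σ S)) '' s) := by
  let φ : MvPolynomial σ S →ₐ[S] MvPolynomial σ S := aeval fun i => X i + C (y i)
  let ψ : MvPolynomial σ S →ₐ[S] MvPolynomial σ S := aeval fun i => X i - C (y i)
  have hψφ : ψ.comp φ = AlgHom.id S _ := by
    ext i; simp [φ, ψ, ← algebraMap_eq]
  have h1 := Ideal.mem_map_of_mem φ h
  rw [Ideal.map_span, Set.image_image] at h1
  have e1 : ∀ i, φ (X i - C (y i)) = X i := by intro i; simp [φ, ← algebraMap_eq]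
  simp only [e1, map_mul] at h1
  have h2 : φ e ∈ Ideal.span (X '' (s : Set σ)) := by
    rw [mem_ideal_span_X_image] at h1 ⊢
    intro m hm
    obtain ⟨i, hi, hne⟩ := h1 (m + Finsupp.single k 1) (by
      rw [mem_support_iff, coeff_mul_X]; exact mem_support_iff.1 hm)
    refine ⟨i, hi, ?_⟩
    have : k ≠ i := fun h => hk (h ▸ hi)
    simpa [Finsupp.single_apply, this] using hne
  have h3 := Ideal.mem_map_of_mem ψ h2
  rw [Ideal.map_span, Set.image_image] at h3
  have e2 : ψ (φ e) = e := by
    have := congrArg (fun F => F e) hψφ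
    simpa using this
  rw [e2] at h3
  simpa [ψ] using h3


/-- Polynomials in `x` over `R[y]` whose coefficients have degree at most `d`. -/
def W (R σ : Type*) [CommRing R] (d : ℕ) :
    AddSubmonoid (MvPolynomial σ (MvPolynomial σ R)) where
  carrier := {t | ∀ c, (coeff c t).totalDegree ≤ d}
  zero_mem' := by intro c; simp
  add_mem' := by
    intro a b ha hb c
    rw [coeff_add]
    exact (totalDegree_add _ _).trans (max_le (ha c) (hb c))

theorem W_mono {R σ : Type*} [CommRing R] {d e : ℕ} (h : d ≤ e) : W R σ d ≤ W R σ e :=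
  fun _ ht c => (ht c).trans h

theorem W_mul {R σ : Type*} [CommRing R] {d e : ℕ} {s t : MvPolynomial σ (MvPolynomial σ R)}
    (hs : s ∈ W R σ d) (ht : t ∈ W R σ e) : s * t ∈ W R σ (d + e) := by
  classical
  intro c
  rw [coeff_mul]
  refine totalDegree_finsetSum_le fun x _ => ?_
  exact (totalDegree_mul _ _).trans (add_le_add (hs _) (ht _))

theorem W_prod {R σ ι : Type*} [CommRing R] (s : Finset ι) (d : ι → ℕ)
    (t : ι → MvPolynomial σ (MvPolynomial σ R))
    (h : ∀ i ∈ s, t i ∈ W R σ (d i)) : ∏ i ∈ s, t i ∈ W R σ (∑ i ∈ s, d i) := by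
  classical
  induction s using Finset.induction_on with
  | empty =>
    intro c
    simp only [Finset.prod_empty, Finset.sum_empty, coeff_one]
    split_ifs <;> simp
  | insert k s hk ih =>
    rw [Finset.prod_insert hk, Finset.sum_insert hk]
    exact W_mul (h _ (Finset.mem_insert_self _ _))
      (ih fun i hi => h i (Finset.mem_insert_of_mem hi))

theorem W_map {R σ : Type*} [CommRing R] (g : MvPolynomial σ R) :
    map C g ∈ W R σ 0 := by
  intro c
  rw [coeff_map]; simp

theorem W_C {R σ : Type*} [CommRing R] {d : ℕ} (g : MvPolynomial σ R) (h : g.totalDegree ≤ d) :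
    (C g) ∈ W R σ d := by
  classical
  intro c
  rw [coeff_C]
  split_ifs <;> simp [h]

theorem W_det {R σ : Type*} [CommRing R] [Fintype σ] [DecidableEq σ] (d : σ → ℕ)
    (M : Matrix σ σ (MvPolynomial σ (MvPolynomial σ R)))
    (h : ∀ i j, M i j ∈ W R σ (d i)) : M.det ∈ W R σ (∑ i, d i) := by
  rw [← Matrix.det_transpose, Matrix.det_apply]
  refine sum_mem fun τ _ => ?_
  have h1 : ∏ i, M.transpose (τ i) i ∈ W R σ (∑ i, d i) := W_prod _ _ _ fun i _ => h _ _
  rcases Int.units_eq_one_or (Equiv.Perm.sign τ) with e | e <;> rw [e]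
  · simpa using h1
  · intro c
    have := h1 c
    simpa using this


theorem finsupp_decomp {σ : Type*} [DecidableEq σ] (a : σ →₀ ℕ) (h : a ≠ 0) :
    ∃ (b : σ →₀ ℕ) (i : σ), a = b + Finsupp.single i 1 ∧ a.degree = b.degree + 1 := by
  obtain ⟨i, hi⟩ := Finsupp.ne_iff.1 h
  have hi' : a i ≠ 0 := by simpa using hi
  have e : a = (a - Finsupp.single i 1) + Finsupp.single i 1 := by
    rw [tsub_add_cancel_of_le]
    rw [Finsupp.single_le_iff]
    omega
  refine ⟨a - Finsupp.single i 1, i, e, ?_⟩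
  conv_lhs => rw [e]
  rw [map_add, Finsupp.degree_single]

theorem totalDegree_monomial_le_degree {R σ : Type*} [CommRing R] (a : σ →₀ ℕ) (r : R) :
    (monomial a r).totalDegree ≤ a.degree := by
  have := totalDegree_monomial_le a r
  exact this

theorem dd_monomial {R σ : Type*} [CommRing R] [Fintype σ] [DecidableEq σ] (k : ℕ) :
    ∀ a : σ →₀ ℕ, a.degree = k →
    ∃ M : σ → MvPolynomial σ (MvPolynomial σ R),
      (∀ i, M i ∈ W R σ (k - 1)) ∧
      map C (monomial a (1 : R)) - C (monomial a (1 : R)) = ∑ i, M i * (X i - C (X i)) := by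
  induction k with
  | zero =>
    intro a ha
    rw [Finsupp.degree_eq_zero_iff] at ha
    subst ha
    refine ⟨0, fun i => zero_mem _, ?_⟩
    simp
  | succ k ih =>
    intro a ha
    obtain ⟨b, j, hab, hd⟩ := finsupp_decomp a (by rintro rfl; simp at ha)
    obtain ⟨M, hM, hMe⟩ := ih b (by omega)
    refine ⟨fun i => X j * M i + if i = j then C (monomial b 1) else 0, fun i => ?_, ?_⟩
    · refine add_mem ?_ ?_
      · have : (X j : MvPolynomial σ (MvPolynomial σ R)) ∈ W R σ 0 := by
          simpa using W_map (R := R) (X j : MvPolynomial σ R)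
        exact W_mono (by omega) (W_mul this (hM i))
      · split_ifs
        · exact W_C _ ((totalDegree_monomial_le_degree _ _).trans (by omega))
        · exact zero_mem _
    · simp_rw [add_mul, mul_assoc]
      rw [Finset.sum_add_distrib, ← Finset.mul_sum, ← hMe]
      simp only [ite_mul, zero_mul, Finset.sum_ite_eq', Finset.mem_univ, if_true]
      rw [hab, monomial_add_single, pow_one, map_mul, C_mul, map_X]
      ring

theorem dd {R σ : Type*} [CommRing R] [Fintype σ] [DecidableEq σ] (f : MvPolynomial σ R) :
    ∃ M : σ → MvPolynomial σ (MvPolynomial σ R),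
      (∀ i, M i ∈ W R σ (f.totalDegree - 1)) ∧
      map C f - C f = ∑ i, M i * (X i - C (X i)) := by
  choose M hM hMe using fun a : σ →₀ ℕ => dd_monomial (R := R) a.degree a rfl
  refine ⟨fun i => ∑ a ∈ f.support, map C (C (coeff a f)) * M a i, fun i => ?_, ?_⟩
  · refine sum_mem fun a ha => ?_
    have h1 : a.degree ≤ f.totalDegree := le_totalDegree ha
    exact W_mono (by omega) (W_mul (W_map (C (coeff a f))) (hM a i))
  · simp_rw [Finset.sum_mul]
    rw [Finset.sum_comm]
    simp_rw [mul_assoc, ← Finset.mul_sum, ← hMe]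
    conv_lhs => rw [f.as_sum]
    rw [map_sum, map_sum, ← Finset.sum_sub_distrib]
    refine Finset.sum_congr rfl fun a _ => ?_
    have : monomial a (coeff a f) = C (coeff a f) * monomial a 1 := by
      rw [C_mul_monomial, mul_one]
    rw [this, map_mul, C_mul, mul_sub, map_C]

theorem exists_seq {R : Type*} [CommRing R] [Nontrivial R] (p : Polynomial R) (hp : p.Monic) (m : ℕ)
    (hm : p.natDegree = m + 1) :
    ∃ l : ℕ → R, (∀ a, ∑ c ∈ Finset.range (m + 2), p.coeff c * l (a + c) = 0) ∧
      (∀ c, c < m → l c = 0) ∧ l m = 1 := by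
  have hdeg : p.degree = (m + 1 : ℕ) := by
    rw [Polynomial.degree_eq_natDegree hp.ne_zero, hm]
  refine ⟨fun c => ((Polynomial.X ^ c : Polynomial R) %ₘ p).coeff m, ?_, ?_, ?_⟩
  · intro a
    have h1 : p * Polynomial.X ^ a = ∑ c ∈ Finset.range (m + 2),
        p.coeff c • (Polynomial.X ^ (a + c) : Polynomial R) := by
      conv_lhs => rw [p.as_sum_range_C_mul_X_pow, hm]
      rw [Finset.sum_mul]
      refine Finset.sum_congr rfl fun c _ => ?_
      rw [Polynomial.smul_eq_C_mul, pow_add]; ring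
    have h2 : (p * Polynomial.X ^ a) %ₘ p = 0 :=
      (Polynomial.modByMonic_eq_zero_iff_dvd hp).2 (dvd_mul_right _ _)
    have h3 := congrArg (fun q => Polynomial.coeff (Polynomial.modByMonicHom p q) m) h1
    simp only [map_sum, map_smul, Polynomial.modByMonicHom_apply, h2, Polynomial.finsetSum_coeff,
      Polynomial.coeff_smul, smul_eq_mul, Polynomial.coeff_zero] at h3
    exact h3.symm
  · intro c hc
    have : (Polynomial.X ^ c : Polynomial R) %ₘ p = Polynomial.X ^ c := by
      rw [Polynomial.modByMonic_eq_self_iff hp, hdeg, Polynomial.degree_X_pow]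
      exact WithBot.coe_lt_coe.2 (Nat.lt_succ_of_lt hc)
    simp only [this, Polynomial.coeff_X_pow]
    rw [if_neg (by omega)]
  · have : (Polynomial.X ^ m : Polynomial R) %ₘ p = Polynomial.X ^ m := by
      rw [Polynomial.modByMonic_eq_self_iff hp, hdeg, Polynomial.degree_X_pow]
      exact WithBot.coe_lt_coe.2 (Nat.lt_succ_self m)
    simp [this]

/-- The `S`-linear functional on `S[x]`, `S = R[y]`, with `x^a ↦ ∏ i, l i (a i)`. -/
noncomputable def Lam {R σ : Type*} [CommRing R] [Fintype σ] (l : σ → ℕ → R) :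
    MvPolynomial σ (MvPolynomial σ R) →ₗ[MvPolynomial σ R] MvPolynomial σ R :=
  (basisMonomials σ (MvPolynomial σ R)).constr (MvPolynomial σ R)
    fun a => C (∏ i, l i (a i))

theorem Lam_monomial {R σ : Type*} [CommRing R] [Fintype σ] (l : σ → ℕ → R) (a : σ →₀ ℕ)
    (s : MvPolynomial σ R) : Lam l (monomial a s) = s * C (∏ i, l i (a i)) := by
  have h : monomial a s = s • (basisMonomials σ (MvPolynomial σ R) a) := by
    simp [smul_monomial]
  rw [h, map_smul, Lam, Module.Basis.constr_basis, smul_eq_mul]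

theorem Lam_degree {R σ : Type*} [CommRing R] [Fintype σ] (l : σ → ℕ → R) (d : ℕ)
    (t : MvPolynomial σ (MvPolynomial σ R)) (h : t ∈ W R σ d) : (Lam l t).totalDegree ≤ d := by
  rw [t.as_sum, map_sum]
  refine totalDegree_finsetSum_le fun a _ => ?_
  rw [Lam_monomial]
  refine (totalDegree_mul _ _).trans ?_
  rw [totalDegree_C, add_zero]
  exact h a

theorem Lam_kill {R σ : Type*} [CommRing R] [Fintype σ] [DecidableEq σ] (l : σ → ℕ → R)
    (i : σ) (p : Polynomial R) (N : ℕ) (hN : p.natDegree < N)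
    (h : ∀ a, ∑ c ∈ Finset.range N, p.coeff c * l i (a + c) = 0)
    (t : MvPolynomial σ (MvPolynomial σ R)) :
    Lam l (map C (Polynomial.aeval (X i : MvPolynomial σ R) p) * t) = 0 := by
  rw [t.as_sum, Finset.mul_sum, map_sum]
  refine Finset.sum_eq_zero fun a _ => ?_
  rw [Polynomial.aeval_eq_sum_range' hN, map_sum, Finset.sum_mul, map_sum]
  have : ∀ c, Lam l (map C (p.coeff c • (X i : MvPolynomial σ R) ^ c) * monomial a (coeff a t)) =
      coeff a t * C ((p.coeff c * l i (a i + c)) * ∏ k ∈ Finset.univ.erase i, l k (a k)) := by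
    intro c
    have e : map C (p.coeff c • (X i : MvPolynomial σ R) ^ c) * monomial a (coeff a t) =
        monomial (a + Finsupp.single i c) (coeff a t * C (p.coeff c)) := by
      rw [smul_eq_C_mul, map_mul, map_C, map_pow, map_X, X_pow_eq_monomial, mul_assoc,
        monomial_mul, C_mul_monomial]
      congr 1
      · rw [add_comm]
      · ring
    rw [e, Lam_monomial, ← Finset.mul_prod_erase _ _ (Finset.mem_univ i), mul_assoc, ← C_mul]
    have : ∏ k ∈ Finset.univ.erase i, l k ((a + Finsupp.single i c) k) =
        ∏ k ∈ Finset.univ.erase i, l k (a k) := by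
      refine Finset.prod_congr rfl fun k hk => ?_
      have := Finset.ne_of_mem_erase hk
      simp [this.symm]
    rw [this]
    simp [mul_assoc]
  simp_rw [this]
  rw [← Finset.mul_sum, ← map_sum, ← Finset.sum_mul, h]
  simp

theorem Lam_prod {R σ : Type*} [CommRing R] [Fintype σ] [DecidableEq σ] (l : σ → ℕ → R)
    (Q : σ → Polynomial (MvPolynomial σ R)) :
    Lam l (∏ i, Polynomial.aeval (X i : MvPolynomial σ (MvPolynomial σ R)) (Q i)) =
      ∏ i, ∑ c ∈ Finset.range ((Q i).natDegree + 1), (Q i).coeff c * C (l i c) := by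
  simp_rw [Polynomial.aeval_eq_sum_range]
  rw [Finset.prod_univ_sum, Finset.prod_univ_sum, map_sum]
  refine Finset.sum_congr rfl fun c _ => ?_
  have : ∏ i, (Q i).coeff (c i) • (X i : MvPolynomial σ (MvPolynomial σ R)) ^ c i =
      monomial (Finsupp.equivFunOnFinite.symm c) (∏ i, (Q i).coeff (c i)) := by
    rw [monomial_eq, Finsupp.prod_fintype _ _ (by simp), map_prod, ← Finset.prod_mul_distrib]
    refine Finset.prod_congr rfl fun i _ => ?_
    rw [smul_eq_C_mul]; rfl
  rw [this, Lam_monomial, Finset.prod_mul_distrib, map_prod]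
  rfl


theorem Lam_Q {R : Type*} [CommRing R] [Nontrivial R] {S : Type*} [CommRing S] [Nontrivial S]
    (φ : R →+* S) (y : S)
    (p : Polynomial R) (hp : p.Monic) (m : ℕ) (hm : p.natDegree = m + 1) (l : ℕ → R)
    (h0 : ∀ c, c < m → l c = 0) (h1 : l m = 1) :
    ∃ Q : Polynomial S, (Polynomial.X - Polynomial.C y) * Q =
        p.map φ - Polynomial.C ((p.map φ).eval y) ∧
      ∑ c ∈ Finset.range (Q.natDegree + 1), Q.coeff c * φ (l c) = 1 := by
  have hP : (p.map φ).Monic := hp.map φ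
  have hPd : (p.map φ).natDegree = m + 1 := by rw [hp.natDegree_map, hm]
  have hX : (Polynomial.X - Polynomial.C y).Monic := Polynomial.monic_X_sub_C y
  have hQd : ((p.map φ) /ₘ (Polynomial.X - Polynomial.C y)).natDegree = m := by
    rw [Polynomial.natDegree_divByMonic _ hX, hPd, Polynomial.natDegree_X_sub_C]; rfl
  have hQ1 : ((p.map φ) /ₘ (Polynomial.X - Polynomial.C y)).Monic := by
    rw [Polynomial.Monic, Polynomial.leadingCoeff_divByMonic_of_monic hX, hP.leadingCoeff]
    rw [Polynomial.degree_X_sub_C, Polynomial.degree_eq_natDegree hP.ne_zero, hPd]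
    exact WithBot.coe_le_coe.2 (Nat.le_add_left 1 m)
  refine ⟨(p.map φ) /ₘ (Polynomial.X - Polynomial.C y), ?_, ?_⟩
  · have := Polynomial.modByMonic_add_div (p.map φ) (Polynomial.X - Polynomial.C y)
    rw [Polynomial.modByMonic_X_sub_C_eq_C_eval] at this
    rw [eq_sub_iff_add_eq, add_comm]
    exact this
  · rw [hQd, Finset.sum_range_succ, Finset.sum_eq_zero, h1]
    · have : ((p.map φ) /ₘ (Polynomial.X - Polynomial.C y)).coeff m = 1 := by
        have := hQ1.coeff_natDegree
        rwa [hQd] at this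
      simp [this]
    · intro c hc
      rw [h0 c (Finset.mem_range.1 hc)]; simp

theorem det_congr {T σ : Type*} [CommRing T] [DecidableEq σ] [Fintype σ] (J : Ideal T)
    (A B : Matrix σ σ T) (h : ∀ i j, A i j - B i j ∈ J) : A.det - B.det ∈ J := by
  rw [← Ideal.Quotient.eq, RingHom.map_det, RingHom.map_det]
  congr 1
  ext k i
  simp only [RingHom.mapMatrix_apply, Matrix.map_apply]
  rw [Ideal.Quotient.eq]
  exact h k i

theorem exists_low {R σ : Type*} [CommRing R] [Fintype σ] [DecidableEq σ]
    (f : σ → MvPolynomial σ R)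
    (hfg : Module.Finite R (MvPolynomial σ R ⧸ Ideal.span (Set.range f)))
    (g : MvPolynomial σ R) :
    ∃ r : MvPolynomial σ R, r.totalDegree ≤ ∑ i, ((f i).totalDegree - 1) ∧
      g - r ∈ Ideal.span (Set.range f) := by
  cases subsingleton_or_nontrivial R with
  | inl h => exact ⟨0, by simp, by rw [Subsingleton.elim (g - 0) 0]; exact zero_mem _⟩
  | inr hnt =>
  set I := Ideal.span (Set.range f) with hI
  -- monic polynomials in the ideal
  have hmon : ∀ i, ∃ p : Polynomial R, p.Monic ∧ p.natDegree ≠ 0 ∧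
      Polynomial.aeval (X i : MvPolynomial σ R) p ∈ I := by
    intro i
    obtain ⟨p, hp, hp0⟩ := Algebra.IsIntegral.isIntegral (R := R) (Ideal.Quotient.mk I (X i))
    refine ⟨p * Polynomial.X, hp.mul Polynomial.monic_X, ?_, ?_⟩
    · rw [hp.natDegree_mul Polynomial.monic_X]; simp
    · rw [map_mul]
      refine Ideal.mul_mem_right _ _ ?_
      rw [← Ideal.Quotient.eq_zero_iff_mem]
      have := Polynomial.aeval_algHom_apply (Ideal.Quotient.mkₐ R I) (X i) p
      rw [Ideal.Quotient.mkₐ_eq_mk] at this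
      rw [← this]
      exact hp0
  choose p hp hpd hpI using hmon
  have hm : ∀ i, ∃ m, (p i).natDegree = m + 1 := fun i => Nat.exists_eq_succ_of_ne_zero (hpd i)
  choose m hm using hm
  have hH : ∀ i, ∃ H : σ → MvPolynomial σ R,
      ∑ j, H j * f j = Polynomial.aeval (X i : MvPolynomial σ R) (p i) := by
    intro i
    have := (Ideal.mem_span_range_iff_exists_fun).1 (hpI i)
    exact this
  choose H hH using hH
  choose l hl hl0 hl1 using fun i => exists_seq (p i) (hp i) (m i) (hm i)
  choose Q hQ hQ1 using fun i => Lam_Q (S := MvPolynomial σ R) C (X i) (p i) (hp i) (m i) (hm i)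
    (l i) (hl0 i) (hl1 i)
  choose M hMW hM using fun j => dd (f j)
  choose N _ hN using fun k j => dd (H k j)
  obtain ⟨G, _, hG⟩ := dd g
  let pp : σ → MvPolynomial σ R := fun i => Polynomial.aeval (X i : MvPolynomial σ R) (p i)
  let v : σ → MvPolynomial σ (MvPolynomial σ R) := fun i => X i - C (X i)
  let w : σ → MvPolynomial σ (MvPolynomial σ R) := fun i => map C (pp i) - C (pp i)
  let A : Matrix σ σ (MvPolynomial σ (MvPolynomial σ R)) :=
    Matrix.diagonal fun i => Polynomial.aeval (X i) (Q i)
  let B : Matrix σ σ (MvPolynomial σ (MvPolynomial σ R)) :=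
    Matrix.of fun k i => ∑ j, (map C (H k j) * M j i + C (f j) * N k j i)
  let Hx : Matrix σ σ (MvPolynomial σ (MvPolynomial σ R)) := Matrix.of fun k j => map C (H k j)
  let MM : Matrix σ σ (MvPolynomial σ (MvPolynomial σ R)) := Matrix.of M
  let HM : Matrix σ σ (MvPolynomial σ R) := Matrix.of H
  let 𝔞 : Ideal (MvPolynomial σ (MvPolynomial σ R)) :=
    Ideal.span (Set.range fun j => C (f j)) ⊔ Ideal.span (Set.range fun i => map C (pp i))
  have ha1 : ∀ j, C (f j) ∈ 𝔞 := fun j => Ideal.mem_sup_left (Ideal.subset_span ⟨j, rfl⟩)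
  have ha2 : ∀ i, map C (pp i) ∈ 𝔞 := fun j => Ideal.mem_sup_right (Ideal.subset_span ⟨j, rfl⟩)
  have ha3 : ∀ i, C (pp i) ∈ 𝔞 := by
    intro i
    have : pp i = ∑ j, H i j * f j := (hH i).symm
    rw [this, map_sum]
    refine Ideal.sum_mem _ fun j _ => ?_
    rw [C_mul]
    exact Ideal.mul_mem_left _ _ (ha1 j)
  have hLam : ∀ t ∈ 𝔞, Lam l t ∈ I := by
    intro t ht
    obtain ⟨t1, ht1, t2, ht2, rfl⟩ := Submodule.mem_sup.1 ht
    obtain ⟨c, rfl⟩ := (Ideal.mem_span_range_iff_exists_fun).1 ht1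
    obtain ⟨c', rfl⟩ := (Ideal.mem_span_range_iff_exists_fun).1 ht2
    rw [map_add, map_sum, map_sum]
    refine add_mem (Ideal.sum_mem _ fun j _ => ?_) (Ideal.sum_mem _ fun i _ => ?_)
    · rw [mul_comm, ← smul_eq_C_mul, map_smul, smul_eq_mul]
      exact Ideal.mul_mem_right _ _ (Ideal.subset_span ⟨j, rfl⟩)
    · rw [mul_comm, Lam_kill l i (p i) (m i + 2) (by rw [hm]; omega) (hl i)]
      exact zero_mem _
  -- the two matrices
  have hAv : ∀ i, ∑ j, A i j * v j = w i := by
    intro i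
    have h1 : ∑ j, A i j * v j = Polynomial.aeval (X i) (Q i) * v i := by
      simp [A, Matrix.diagonal_apply]
    have h2 := congrArg (Polynomial.aeval (X i : MvPolynomial σ (MvPolynomial σ R))) (hQ i)
    rw [map_mul, map_sub, map_sub, Polynomial.aeval_X, Polynomial.aeval_C, Polynomial.aeval_C,
      mul_comm] at h2
    rw [h1]
    refine h2.trans ?_
    have e1 : Polynomial.aeval (X i : MvPolynomial σ (MvPolynomial σ R)) 
        ((p i).map (C : R →+* MvPolynomial σ R)) = map C (pp i) := by
      simp only [pp, Polynomial.aeval_def, Polynomial.eval₂_map, Polynomial.hom_eval₂, map_X]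
      congr 1
      ext r : 1
      simp [algebraMap_eq]
    have e2 : ((p i).map C).eval (X i : MvPolynomial σ R) = pp i := by
      simp only [pp, Polynomial.aeval_def, Polynomial.eval_map, algebraMap_eq]
    rw [e1, e2, algebraMap_eq]
  have hBv : ∀ i, ∑ j, B i j * v j = w i := by
    intro k
    have h1 : w k = ∑ j, (map C (H k j) * (map C (f j) - C (f j)) +
        C (f j) * (map C (H k j) - C (H k j))) := by
      have : pp k = ∑ j, H k j * f j := (hH k).symm
      simp only [w]
      rw [this, map_sum, map_sum, ← Finset.sum_sub_distrib]
      refine Finset.sum_congr rfl fun j _ => ?_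
      rw [map_mul, C_mul]; ring
    rw [h1]
    simp only [B, Matrix.of_apply, Finset.sum_mul]
    rw [Finset.sum_comm]
    refine Finset.sum_congr rfl fun j _ => ?_
    rw [hM, hN, Finset.mul_sum, Finset.mul_sum, ← Finset.sum_add_distrib]
    refine Finset.sum_congr rfl fun i _ => ?_
    simp only [v]
    ring
  have hAB : A.det - B.det ∈ 𝔞 := by
    have h := det_sub v (fun s k hk e he => var_reg (fun i => (X i : MvPolynomial σ R)) s k hk e he)
      w A B hAv hBv
    refine (Ideal.span_le.2 ?_) h
    rintro _ ⟨i, rfl⟩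
    exact sub_mem (ha2 i) (ha3 i)
  have hBHM : B.det - (Hx * MM).det ∈ 𝔞 := by
    refine det_congr 𝔞 _ _ fun k i => ?_
    simp only [B, Hx, MM, Matrix.mul_apply, Matrix.of_apply]
    rw [← Finset.sum_sub_distrib]
    refine Ideal.sum_mem _ fun j _ => ?_
    rw [add_sub_cancel_left]
    exact Ideal.mul_mem_right _ _ (ha1 j)
  have hHx : Hx.det = map C HM.det := by
    rw [RingHom.map_det]; rfl
  have hHf : ∀ j, Hx.det * map C (f j) ∈ 𝔞 := by
    intro j
    have h1 : HM.det * f j = ∑ k, HM.adjugate j k * pp k := by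
      have h2 : HM.adjugate.mulVec (HM.mulVec f) = HM.det • f := by
        rw [Matrix.mulVec_mulVec, Matrix.adjugate_mul, Matrix.smul_mulVec, Matrix.one_mulVec]
      have h3 : HM.mulVec f = pp := by
        ext1 k
        exact hH k
      rw [h3] at h2
      exact (congrFun h2 j).symm
    rw [hHx, ← map_mul, h1, map_sum]
    refine Ideal.sum_mem _ fun k _ => ?_
    rw [map_mul]
    exact Ideal.mul_mem_left _ _ (ha2 k)
  have hvM : ∀ i, Hx.det * (MM.det * v i) ∈ 𝔞 := by
    intro i
    have h2 : MM.adjugate.mulVec (MM.mulVec v) = MM.det • v := by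
      rw [Matrix.mulVec_mulVec, Matrix.adjugate_mul, Matrix.smul_mulVec, Matrix.one_mulVec]
    have h3 : MM.mulVec v = fun j => map C (f j) - C (f j) := by
      ext1 j
      exact (hM j).symm
    rw [h3] at h2
    have h4 : MM.det * v i = ∑ j, MM.adjugate i j * (map C (f j) - C (f j)) :=
      (congrFun h2 i).symm
    rw [h4, Finset.mul_sum]
    refine Ideal.sum_mem _ fun j _ => ?_
    have : Hx.det * (MM.adjugate i j * (map C (f j) - C (f j))) =
      MM.adjugate i j * (Hx.det * map C (f j) - Hx.det * C (f j)) := by ring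
    rw [this]
    exact Ideal.mul_mem_left _ _ (sub_mem (hHf j) (Ideal.mul_mem_left _ _ (ha1 j)))
  have hgg : Hx.det * MM.det * (map C g - C g) ∈ 𝔞 := by
    rw [hG, Finset.mul_sum]
    refine Ideal.sum_mem _ fun i _ => ?_
    have : Hx.det * MM.det * (G i * (X i - C (X i))) = G i * (Hx.det * (MM.det * v i)) := by
      simp only [v]; ring
    rw [this]
    exact Ideal.mul_mem_left _ _ (hvM i)
  have hfin : C g * A.det - map C (g * HM.det) * MM.det ∈ 𝔞 := by
    have := sub_mem (Ideal.mul_mem_left 𝔞 (C g) (add_mem hAB hBHM)) hgg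
    convert this using 1
    rw [Matrix.det_mul, map_mul, ← hHx]
    ring
  refine ⟨Lam l (map C (g * HM.det) * MM.det), ?_, ?_⟩
  · apply Lam_degree
    have := W_mul (W_map (g * HM.det)) (W_det (fun i => (f i).totalDegree - 1) MM hMW)
    rwa [zero_add] at this
  · have h1 := hLam _ hfin
    rw [map_sub, ← smul_eq_C_mul, map_smul, smul_eq_mul, Matrix.det_diagonal, Lam_prod] at h1
    have : ∏ i, ∑ c ∈ Finset.range ((Q i).natDegree + 1), (Q i).coeff c * C (l i c) = 1 :=
      Finset.prod_eq_one fun i _ => hQ1 i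
    rwa [this, mul_one] at h1

theorem mul_deg_le {R σ : Type*} [CommRing R] (a b : ℕ) :
    restrictTotalDegree σ R a * restrictTotalDegree σ R b ≤ restrictTotalDegree σ R (a + b) := by
  rw [Submodule.mul_le]
  intro x hx y hy
  rw [mem_restrictTotalDegree] at *
  exact (totalDegree_mul _ _).trans (add_le_add hx hy)

theorem step {R σ : Type*} [CommRing R] [DecidableEq σ] (I : Ideal (MvPolynomial σ R)) (d D : ℕ)
    (hD : d + 1 ≤ D)
    (h : ∀ g, ∃ r : MvPolynomial σ R, r.totalDegree ≤ d ∧ g - r ∈ I) :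
    I.restrictScalars R ⊓ restrictTotalDegree σ R (D + 1) ≤
      (I.restrictScalars R ⊓ restrictTotalDegree σ R D) * restrictTotalDegree σ R 1 := by
  set P := (I.restrictScalars R ⊓ restrictTotalDegree σ R D) * restrictTotalDegree σ R 1 with hP
  have hPI : P ≤ I.restrictScalars R := by
    rw [hP, Submodule.mul_le]
    intro x hx y _
    exact Ideal.mul_mem_right _ _ hx.1
  have hIP : I.restrictScalars R ⊓ restrictTotalDegree σ R D ≤ P := by
    intro x hx
    rw [← mul_one x]
    exact Submodule.mul_mem_mul hx (by rw [mem_restrictTotalDegree]; simp)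
  have key : restrictTotalDegree σ R (D + 1) ≤ P ⊔ restrictTotalDegree σ R (d + 1) := by
    intro g hg
    rw [mem_restrictTotalDegree] at hg
    rw [g.as_sum]
    refine sum_mem fun a ha => ?_
    have hda : a.degree ≤ D + 1 := (le_totalDegree ha).trans hg
    by_cases ha0 : a = 0
    · subst ha0
      refine Submodule.mem_sup_right ?_
      rw [mem_restrictTotalDegree]
      exact (totalDegree_monomial_le_degree _ _).trans (by simp)
    · obtain ⟨b, i, rfl, hdeg⟩ := finsupp_decomp a ha0
      obtain ⟨r, hr, hrI⟩ := h (monomial b (coeff (b + Finsupp.single i 1) g))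
      rw [monomial_add_single, pow_one]
      have hXd : (X i : MvPolynomial σ R).totalDegree ≤ 1 := by
        have := totalDegree_monomial_le_degree (R := R) (Finsupp.single i 1) 1
        rwa [Finsupp.degree_single] at this
      have e : monomial b (coeff (b + Finsupp.single i 1) g) * X i =
          (monomial b (coeff (b + Finsupp.single i 1) g) - r) * X i + r * X i := by ring
      rw [e]
      refine add_mem (Submodule.mem_sup_left ?_) (Submodule.mem_sup_right ?_)
      · refine Submodule.mul_mem_mul ⟨hrI, ?_⟩ ?_
        · refine sub_mem ?_ ?_
          · rw [mem_restrictTotalDegree]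
            exact (totalDegree_monomial_le_degree _ _).trans (by omega)
          · rw [mem_restrictTotalDegree]; omega
        · rwa [mem_restrictTotalDegree]
      · rw [mem_restrictTotalDegree]
        exact (totalDegree_mul _ _).trans (add_le_add hr hXd)
  rintro g ⟨hgI, hg⟩
  obtain ⟨a, ha, b, hb, rfl⟩ := Submodule.mem_sup.1 (key hg)
  refine add_mem ha (hIP ⟨?_, ?_⟩)
  · have : b = (a + b) - a := by ring
    rw [this]
    exact sub_mem hgI (hPI ha)
  · rw [SetLike.mem_coe, mem_restrictTotalDegree] at *
    omega

theorem steps {R σ : Type*} [CommRing R] [DecidableEq σ] (I : Ideal (MvPolynomial σ R)) (d D : ℕ)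
    (hD : d + 1 ≤ D)
    (h : ∀ g, ∃ r : MvPolynomial σ R, r.totalDegree ≤ d ∧ g - r ∈ I) (k : ℕ) :
    I.restrictScalars R ⊓ restrictTotalDegree σ R (D + k) ≤
      (I.restrictScalars R ⊓ restrictTotalDegree σ R D) * restrictTotalDegree σ R k := by
  induction k with
  | zero =>
    intro x hx
    rw [← mul_one x]
    exact Submodule.mul_mem_mul hx (by rw [mem_restrictTotalDegree]; simp)
  | succ k ih =>
    refine (step I d (D + k) (by omega) h).trans ?_
    refine (mul_le_mul_left ih _).trans ?_
    rw [mul_assoc]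
    exact mul_le_mul_right (mul_deg_le k 1) _

end BezAux

/-- If `R[x]/(f)_x` is a finitely generated `R`-module, then for all `δ, ε ≥ 0`,
`(f)_x ∩ R[x^{≤δ_f+δ+ε+1}] = ((f)_x ∩ R[x^{≤δ_f+ε+1}])·R[x^{≤δ}]`. -/
theorem ideal_inter_degreeLE_eq_product
    (R : Type*) [CommRing R] (n : ℕ) (f : Fin n → MvPolynomial (Fin n) R)
    (hdeg : ∀ i, 1 ≤ (f i).totalDegree)
    (δf : ℕ) (hδf : δf = ∑ i, ((f i).totalDegree - 1))
    (hfg : Module.Finite R (MvPolynomial (Fin n) R ⧸ Ideal.span (Set.range f)))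
    (δ ε : ℕ) :
    (Ideal.span (Set.range f)).restrictScalars R ⊓
        MvPolynomial.restrictTotalDegree (Fin n) R (δf + δ + ε + 1) =
      ((Ideal.span (Set.range f)).restrictScalars R ⊓
          MvPolynomial.restrictTotalDegree (Fin n) R (δf + ε + 1)) *
        MvPolynomial.restrictTotalDegree (Fin n) R δ := by
  subst hδf
  have hlow := BezAux.exists_low f hfg
  apply le_antisymm
  · have := BezAux.steps (Ideal.span (Set.range f)) _
      (∑ i, ((f i).totalDegree - 1) + ε + 1) (by omega) hlow δ
    have e : ∑ i, ((f i).totalDegree - 1) + δ + ε + 1 =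
        ∑ i, ((f i).totalDegree - 1) + ε + 1 + δ := by ring
    rw [e]
    exact this
  · rw [Submodule.mul_le]
    rintro x ⟨hx1, hx2⟩ y hy
    refine ⟨Ideal.mul_mem_right _ _ hx1, ?_⟩
    rw [SetLike.mem_coe, MvPolynomial.mem_restrictTotalDegree] at *
    have := MvPolynomial.totalDegree_mul x y
    omega
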